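/- arXiv:1702.02037 — 4 statements merged into one kernel-verified Lean document; each statement's English description precedes it below -/
import Mathlib

section
/- Let n ≥ 3 be an integer and let a, b be nonzero complex numbers satisfying a b^{n−2} ≠ 2. Then the polynomial P(z) = a z^n − n(n−1) z^2 + 2n(n−2) b z − (n−1)(n−2) b^2 has no common zero with its derivative P'; equivalently, every zero of P is simple (P is squarefree in ℂ[X]). -/
open Polynomial in
theorem squarefree_of_eval_derivative_ne_zero {k : Type*} [Field k] [IsAlgClosed k] {p : k[X]}
    (h : ∀ z : k, p.eval z = 0 → (derivative p).eval z ≠ 0) : Squarefree p := by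
  refine Separable.squarefree ?_
  rw [separable_def]
  refine (isCoprime_iff_aeval_ne_zero_of_isAlgClosed k k p (derivative p)).2 fun z => ?_
  rw [coe_aeval_eq_eval]
  by_cases hz : p.eval z = 0
  · exact Or.inr (h z hz)
  · exact Or.inl hz

open Polynomial in
theorem P_has_only_simple_zeros (n : ℕ) (hn : 3 ≤ n) (a b : ℂ) (ha : a ≠ 0) (hb : b ≠ 0)
    (hab : a * b ^ (n - 2) ≠ 2)
    (P : ℂ[X])
    (hP : P = C a * X ^ n - C ((n : ℂ) * (n - 1)) * X ^ 2
      + C (2 * (n : ℂ) * (n - 2) * b) * X - C (((n : ℂ) - 1) * ((n : ℂ) - 2) * b ^ 2)) :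
    (∀ z₀ : ℂ, P.eval z₀ = 0 → (derivative P).eval z₀ ≠ 0) ∧ Squarefree P := by
  have simple : ∀ z₀ : ℂ, P.eval z₀ = 0 → (derivative P).eval z₀ ≠ 0 := by
    obtain ⟨m, rfl⟩ : ∃ m, n = m + 2 := ⟨n - 2, by omega⟩
    have hm : (m : ℂ) ≠ 0 := Nat.cast_ne_zero.2 (by omega)
    have hm1 : (m : ℂ) + 1 ≠ 0 := Nat.cast_add_one_ne_zero m
    have hm2 : (m : ℂ) + 2 ≠ 0 := by exact_mod_cast (by omega : m + 2 ≠ 0)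
    rw [Nat.add_sub_cancel] at hab
    intro z h0 h1
    have e0 : a * z ^ (m + 2) - ((m : ℂ) + 2) * (m + 1) * z ^ 2 + 2 * ((m : ℂ) + 2) * m * b * z
        - ((m : ℂ) + 1) * m * b ^ 2 = 0 := by
      rw [← h0, hP]
      simp only [eval_sub, eval_add, eval_mul, eval_C, eval_pow, eval_X]
      push_cast
      ring
    have e1 : ((m : ℂ) + 2) * (a * z ^ (m + 1) - 2 * (m + 1) * z + 2 * m * b) = 0 := by
      rw [← h1, hP]
      simp only [derivative_sub, derivative_add, derivative_C_mul, derivative_X_pow,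
        derivative_X, derivative_C, eval_sub, eval_add, eval_mul, eval_C, eval_pow, eval_X,
        eval_one, eval_zero, show m + 2 - 1 = m + 1 from rfl]
      push_cast
      ring
    have key : ((m : ℂ) + 2) * (m + 1) * m * (z - b) ^ 2 = 0 := by
      linear_combination z * e1 - ((m : ℂ) + 2) * e0
    have hz : z = b := by simpa [hm, hm1, hm2, sub_eq_zero] using key
    subst hz
    have e2 : ((m : ℂ) + 2) * z * (a * z ^ m - 2) = 0 := by linear_combination e1
    exact mul_ne_zero (mul_ne_zero hm2 hb) (sub_ne_zero.2 hab) e2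
  exact ⟨simple, squarefree_of_eval_derivative_ne_zero simple⟩
end

section
/- Let n ≥ 3 be an integer and let a, b be nonzero complex numbers satisfying a b^{n−2} ≠ 2. Then the set S = {z ∈ ℂ : P(z) = 0}, where P(z) = a z^n − n(n−1) z^2 + 2n(n−2) b z − (n−1)(n−2) b^2, contains exactly n elements. -/
open Polynomial in
/-- A nonzero complex polynomial sharing no root with its derivative has as many roots as its
degree. -/
theorem ncard_isRoot_eq_natDegree (p : ℂ[X]) (hp : p ≠ 0)
    (h : ∀ z, p.eval z = 0 → p.derivative.eval z ≠ 0) :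
    {z : ℂ | p.eval z = 0}.ncard = p.natDegree := by
  have hnodup : p.roots.Nodup := by
    rw [Multiset.nodup_iff_count_le_one]
    intro z
    rw [count_roots]
    by_contra! hz
    obtain ⟨h0, h1⟩ := (one_lt_rootMultiplicity_iff_isRoot hp).1 hz
    exact h z h0 h1
  have hset : {z : ℂ | p.eval z = 0} = (p.roots.toFinset : Set ℂ) := by
    ext z
    simp [hp]
  rw [hset, Set.ncard_coe_finset, Multiset.toFinset_card_of_nodup hnodup]
  exact (IsAlgClosed.splits p).natDegree_eq_card_roots.symm

open Polynomial in
theorem zero_set_of_P_has_n_elements (n : ℕ) (hn : 3 ≤ n) (a b : ℂ) (ha : a ≠ 0) (hb : b ≠ 0)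
    (hab : a * b ^ (n - 2) ≠ 2)
    (P : ℂ → ℂ)
    (hP : ∀ z : ℂ, P z = a * z ^ n - (n : ℂ) * (n - 1) * z ^ 2
      + 2 * (n : ℂ) * (n - 2) * b * z - (n - 1 : ℂ) * (n - 2) * b ^ 2) :
    {z : ℂ | P z = 0}.ncard = n := by
  obtain ⟨m, rfl⟩ : ∃ m, n = m + 3 := ⟨n - 3, by omega⟩
  set N : ℂ := ((m + 3 : ℕ) : ℂ) with hN
  have hNm : N = m + 3 := by simp [hN]
  have hN0 : N ≠ 0 := by rw [hN]; exact_mod_cast (by omega : m + 3 ≠ 0)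
  have hN1 : N - 1 ≠ 0 := by
    rw [hNm, show (m : ℂ) + 3 - 1 = ((m + 2 : ℕ) : ℂ) by push_cast; ring]
    exact_mod_cast (by omega : m + 2 ≠ 0)
  have hN2 : N - 2 ≠ 0 := by
    rw [hNm, show (m : ℂ) + 3 - 2 = ((m + 1 : ℕ) : ℂ) by push_cast; ring]
    exact_mod_cast (by omega : m + 1 ≠ 0)
  let q : ℂ[X] := C (-(N * (N - 1))) * X ^ 2 + C (2 * N * (N - 2) * b) * X
    + C (-((N - 1) * (N - 2) * b ^ 2))
  let p : ℂ[X] := C a * X ^ (m + 3) + q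
  have hpeval (z : ℂ) : p.eval z = P z := by
    simp only [p, q, hP, eval_add, eval_mul, eval_C, eval_pow, eval_X]
    ring
  have hqdeg : q.natDegree < (C a * X ^ (m + 3)).natDegree := by
    rw [natDegree_C_mul_X_pow _ _ ha]
    exact natDegree_quadratic_le.trans_lt (by omega)
  have hdeg : p.natDegree = m + 3 := by
    rw [natDegree_add_eq_left_of_natDegree_lt hqdeg, natDegree_C_mul_X_pow _ _ ha]
  have hp0 : p ≠ 0 := by
    intro h
    simp [h] at hdeg
  have hderiv (z : ℂ) : z * p.derivative.eval z
      = N * p.eval z + N * (N - 1) * (N - 2) * (z - b) ^ 2 := by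
    simp only [p, q, derivative_add, derivative_C_mul, derivative_X_pow, derivative_X,
      derivative_C, eval_add, eval_mul, eval_C, eval_pow, eval_X, eval_one, eval_zero, hNm]
    push_cast
    ring
  simp_rw [← hpeval]
  rw [ncard_isRoot_eq_natDegree p hp0, hdeg]
  intro z hz hz'
  have h := hderiv z
  rw [hz, hz', mul_zero, mul_zero, zero_add] at h
  obtain rfl : z = b := by
    have := (mul_eq_zero.1 h.symm).resolve_left (mul_ne_zero (mul_ne_zero hN0 hN1) hN2)
    exact sub_eq_zero.1 (pow_eq_zero_iff two_ne_zero |>.1 this)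
  rw [hpeval, hP] at hz
  have hfac : z ^ 2 * (a * z ^ (m + 1) - 2) = 0 := by
    linear_combination hz
  exact hab (sub_eq_zero.1 ((mul_eq_zero.1 hfac).resolve_left (pow_ne_zero 2 hb)))
end

section
/- Let n ≥ 3 be an integer and define Q(z) = (n−1)^2 (z^n − 1)(z^{n−2} − 1) − n(n−2)(z^{n−1} − 1)^2. Then Q is a monic polynomial of degree 2n−2, and there exist pairwise distinct complex numbers β₁, …, β_{2n−6}, each different from 0 and from 1, such that Q(z) = (z−1)^4 ∏_{i=1}^{2n−6} (z − β_i). -/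
open Polynomial in
theorem Polynomial.eval_one_iterate_derivative_X_pow {R : Type*} [CommRing R] (N j : ℕ) :
    eval 1 (derivative^[j] (X ^ N : R[X])) = (descPochhammer R j).eval (N : R) := by
  simp [iterate_derivative_X_pow_eq_natCast_mul, descPochhammer_eval_eq_descFactorial]

open Polynomial in
theorem Polynomial.Monic.exists_injective_prod_X_sub_C {K : Type*} [Field K] [IsAlgClosed K]
    {g : K[X]} (hg : g.Monic) (hnd : g.roots.Nodup) {d : ℕ} (hd : g.natDegree = d) :
    ∃ β : Fin d → K, Function.Injective β ∧ (∀ i, g.IsRoot (β i)) ∧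
      g = ∏ i, (X - C (β i)) := by
  classical
  have hs := IsAlgClosed.splits g
  have hc : g.roots.toFinset.card = d := by
    rw [Multiset.toFinset_card_of_nodup hnd, ← hd, hs.natDegree_eq_card_roots]
  let e := (g.roots.toFinset.equivFinOfCardEq hc).symm
  refine ⟨fun i => e i, Subtype.val_injective.comp e.injective, fun i => ?_, ?_⟩
  · exact isRoot_of_mem_roots (Multiset.mem_toFinset.mp (e i).2)
  · rw [Equiv.prod_comp e (fun x : g.roots.toFinset => X - C (x : K)),
      Finset.prod_coe_sort g.roots.toFinset (fun x => X - C x)]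
    conv_lhs => rw [hs.eq_prod_roots_of_monic hg]
    rw [Finset.prod, Multiset.toFinset_val, hnd.dedup]

theorem eq_one_of_double_root_relations {K : Type*} [Field K] {k z a : K} (hk : k ≠ 0)
    (hk1 : k ^ 2 - 1 ≠ 0) (h0 : z * (a - 1) ^ 2 = k ^ 2 * a * (z - 1) ^ 2)
    (h1 : 2 * z * (a - 1) = k * (z - 1) * ((k + 1) * z - (k - 1))) : z = 1 := by
  by_contra hz
  have hz' : z - 1 ≠ 0 := sub_ne_zero.mpr hz
  have e1 : 4 * z * a = ((k + 1) * z - (k - 1)) ^ 2 := by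
    apply mul_left_cancel₀ (mul_ne_zero (pow_ne_zero 2 hk) (pow_ne_zero 2 hz'))
    linear_combination (-4 * z) * h0 +
      (2 * z * (a - 1) + k * (z - 1) * ((k + 1) * z - (k - 1))) * h1
  exact mul_ne_zero hk1 (pow_ne_zero 2 hz') (by linear_combination e1 - 2 * h1)

open Polynomial in
theorem factorization_of_Q (n : ℕ) (hn : 3 ≤ n)
    (Q : ℂ[X])
    (hQ : Q = C (((n : ℂ) - 1) ^ 2) * (X ^ n - 1) * (X ^ (n - 2) - 1)
      - C ((n : ℂ) * ((n : ℂ) - 2)) * (X ^ (n - 1) - 1) ^ 2) :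
    Q.Monic ∧ Q.natDegree = 2 * n - 2 ∧
    ∃ β : Fin (2 * n - 6) → ℂ, Function.Injective β ∧
      (∀ i, β i ≠ 0 ∧ β i ≠ 1) ∧
      Q = (X - 1) ^ 4 * ∏ i, (X - C (β i)) := by
  obtain ⟨k, rfl⟩ := Nat.exists_eq_add_of_le' hn
  have hm0 : (k : ℂ) + 2 ≠ 0 := by norm_cast
  have hm1 : ((k : ℂ) + 2) ^ 2 - 1 ≠ 0 := by
    rw [sub_ne_zero]; norm_cast; nlinarith
  have hQ' : Q = X ^ (2 * k + 4) + (C (-((k : ℂ) + 2) ^ 2) * X ^ (k + 3)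
      + C (2 * (((k : ℂ) + 2) ^ 2 - 1)) * X ^ (k + 2)
      + C (-((k : ℂ) + 2) ^ 2) * X ^ (k + 1) + C 1 * X ^ 0) := by
    rw [hQ, show k + 3 - 2 = k + 1 by omega, show k + 3 - 1 = k + 2 by omega]
    simp only [map_mul, map_add, map_sub, map_pow, map_neg, map_natCast, map_ofNat, map_one,
      Nat.cast_add, Nat.cast_ofNat]
    ring
  have hdeg : (C (-((k : ℂ) + 2) ^ 2) * X ^ (k + 3)
      + C (2 * (((k : ℂ) + 2) ^ 2 - 1)) * X ^ (k + 2)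
      + C (-((k : ℂ) + 2) ^ 2) * X ^ (k + 1) + C 1 * X ^ 0).degree < ((2 * k + 4 : ℕ) : WithBot ℕ) := by
    refine degree_le_natDegree.trans_lt (Nat.cast_lt.mpr (Nat.lt_of_le_of_lt (m := k + 3) ?_
      (by omega)))
    compute_degree
  have hmonic : Q.Monic := hQ' ▸ monic_X_pow_add hdeg
  have hnat : Q.natDegree = 2 * k + 4 := by
    rw [hQ', natDegree_add_eq_left_of_degree_lt (by rwa [degree_X_pow]), natDegree_X_pow]
  have hder (j : ℕ) : eval 1 (derivative^[j] Q) =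
      (descPochhammer ℂ j).eval (2 * k + 4 : ℂ)
      - (k + 2) ^ 2 * (descPochhammer ℂ j).eval (k + 3 : ℂ)
      + 2 * ((k + 2) ^ 2 - 1) * (descPochhammer ℂ j).eval (k + 2 : ℂ)
      - (k + 2) ^ 2 * (descPochhammer ℂ j).eval (k + 1 : ℂ)
      + (descPochhammer ℂ j).eval 0 := by
    rw [hQ']
    simp only [iterate_map_add, iterate_derivative_C_mul, eval_add, eval_mul, eval_C,
      eval_one_iterate_derivative_X_pow]
    push_cast
    ring
  have hmult : Q.rootMultiplicity 1 = 4 := by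
    apply le_antisymm
    · rw [← not_lt, lt_rootMultiplicity_iff_isRoot_iterate_derivative hmonic.ne_zero]
      intro h
      have h4 := h 4 le_rfl
      rw [IsRoot, hder] at h4
      simp [descPochhammer_succ_right] at h4
      have : ((k : ℂ) + 2) ^ 2 * (((k : ℂ) + 2) ^ 2 - 1) = 0 := by
        linear_combination h4 / 2
      exact mul_ne_zero (pow_ne_zero 2 hm0) hm1 this
    · rw [Nat.succ_le_iff, lt_rootMultiplicity_iff_isRoot_iterate_derivative hmonic.ne_zero]
      intro j hj
      rw [IsRoot, hder]
      interval_cases j <;> simp [descPochhammer_succ_right] <;> ring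
  have hdouble (z : ℂ) (h0 : Q.IsRoot z) (h1 : (derivative Q).IsRoot z) : z = 1 := by
    have hz : z ≠ 0 := by
      rintro rfl
      simp [hQ'] at h0
    rw [hQ'] at h0 h1
    simp only [IsRoot, eval_add, eval_mul, eval_C, eval_pow, eval_X, derivative_add,
      derivative_C_mul, derivative_X_pow, Nat.add_sub_cancel] at h0 h1
    apply eq_one_of_double_root_relations (a := z ^ (k + 2)) hm0 hm1
    · linear_combination z * h0
    · apply mul_left_cancel₀ (mul_ne_zero hm0 (pow_ne_zero k hz))
      push_cast at h1
      linear_combination h1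
  obtain ⟨g, hg, hg1⟩ := exists_eq_pow_rootMultiplicity_mul_and_not_dvd Q hmonic.ne_zero 1
  rw [hmult] at hg
  have hgm : g.Monic := ((monic_X_sub_C 1).pow 4).of_mul_monic_left (hg ▸ hmonic)
  have hgd : g.natDegree = 2 * (k + 3) - 6 := by
    rw [hg, ((monic_X_sub_C 1).pow 4).natDegree_mul hgm, natDegree_pow, natDegree_X_sub_C] at hnat
    omega
  have hnd : g.roots.Nodup := by
    rw [Multiset.nodup_iff_count_le_one]
    intro z
    rw [count_roots]
    by_contra! h
    obtain ⟨h0, h1⟩ := (one_lt_rootMultiplicity_iff_isRoot hgm.ne_zero).mp h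
    rw [IsRoot] at h0 h1
    refine hg1 (dvd_iff_isRoot.mpr ?_)
    rw [← hdouble z (by simp [hg, h0]) (by simp [hg, h0, h1])]
    exact h0
  obtain ⟨β, hinj, hroot, hprod⟩ := hgm.exists_injective_prod_X_sub_C hnd hgd
  refine ⟨hmonic, by omega, β, hinj, fun i => ⟨fun h => ?_, fun h => ?_⟩, ?_⟩
  · have h0 : Q.IsRoot 0 := by
      rw [hg, ← h]
      exact (hroot i).dvd (dvd_mul_left _ _)
    simp [hQ'] at h0
  · exact hg1 (dvd_iff_isRoot.mpr (h ▸ hroot i))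
  · rw [← hprod, hg, C_1]
end

section
/- Let k ≥ 1 be an integer, let s ∈ ℂ be a primitive sixth root of unity, let c ∈ ℂ satisfy c^k = s, let a be a nonzero complex number, and set S = {0} ∪ {a·s^j : 0 ≤ j ≤ 5} (a set of seven elements). Define f(z) = e^{c z}. Then the k-th derivative of f satisfies f^{(k)} = s·f; for every z ∈ ℂ, f(z) ∈ S if and only if f^{(k)}(z) ∈ S; and f is not identically equal to f^{(k)}. -/
/-- The `n`-th roots of `a ^ n` are the multiples of `a` by powers of a primitive root of unity. -/
theorem IsPrimitiveRoot.exists_eq_mul_pow_iff {K : Type*} [Field K] {s a w : K} {n : ℕ} [NeZero n]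
    (hs : IsPrimitiveRoot s n) (ha : a ≠ 0) :
    (∃ j < n, w = a * s ^ j) ↔ w ^ n = a ^ n := by
  constructor
  · rintro ⟨j, -, rfl⟩
    rw [mul_pow, ← pow_mul, mul_comm j, pow_mul, hs.pow_eq_one, one_pow, mul_one]
  · intro h
    obtain ⟨j, hj, hjw⟩ := hs.eq_pow_of_pow_eq_one (ξ := w / a)
      (by rw [div_pow, h, div_self (pow_ne_zero n ha)])
    exact ⟨j, hj, by rw [hjw, mul_div_cancel₀ w ha]⟩

/-- Zero together with the multiples of `a ≠ 0` by the `n`-th roots of unity has `n + 1` elements. -/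
theorem IsPrimitiveRoot.ncard_insert_zero_mul_pow {K : Type*} [Field K] {s a : K} {n : ℕ}
    (hs : IsPrimitiveRoot s n) (hn : n ≠ 0) (ha : a ≠ 0) :
    (insert 0 {w : K | ∃ j < n, w = a * s ^ j}).ncard = n + 1 := by
  have himage : {w : K | ∃ j < n, w = a * s ^ j} =
      (fun j => a * s ^ j) '' (Finset.range n : Set ℕ) := by
    ext w
    simp [eq_comm]
  have hinj : Set.InjOn (fun j => a * s ^ j) (Finset.range n : Set ℕ) := by
    intro i hi j hj hij
    exact hs.pow_inj (by simpa using hi) (by simpa using hj) (mul_left_cancel₀ ha hij)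
  rw [himage, Set.ncard_insert_of_notMem _ ((Finset.finite_toSet _).image _),
    hinj.ncard_image, Set.ncard_coe_finset, Finset.card_range]
  rintro ⟨j, -, hj⟩
  exact mul_ne_zero ha (pow_ne_zero j (hs.ne_zero hn)) hj


theorem seven_element_set_shared_IM_with_kth_derivative
    (k : ℕ) (hk : 1 ≤ k)
    (s : ℂ) (hs6 : s ^ 6 = 1) (hs_prim : ∀ j : ℕ, 1 ≤ j → j ≤ 5 → s ^ j ≠ 1)
    (c : ℂ) (hc : c ^ k = s)
    (a : ℂ) (ha : a ≠ 0)
    (S : Set ℂ) (hS : S = insert 0 {w : ℂ | ∃ j : ℕ, j ≤ 5 ∧ w = a * s ^ j})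
    (f : ℂ → ℂ) (hf : ∀ z : ℂ, f z = Complex.exp (c * z)) :
    S.ncard = 7 ∧
    (iteratedDeriv k f = fun z => s * f z) ∧
    (∀ z : ℂ, f z ∈ S ↔ iteratedDeriv k f z ∈ S) ∧
    f ≠ iteratedDeriv k f := by
  have hs : IsPrimitiveRoot s 6 :=
    IsPrimitiveRoot.mk_of_lt s (by norm_num) hs6 fun j h0 h6 => hs_prim j h0 (by omega)
  have hderiv : iteratedDeriv k f = fun z => s * f z := by
    rw [funext hf, iteratedDeriv_cexp_const_mul, hc]
  have hset : S = insert 0 {w : ℂ | ∃ j < 6, w = a * s ^ j} := by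
    simpa only [Nat.lt_succ_iff] using hS
  have hmem (w : ℂ) : w ∈ S ↔ w = 0 ∨ w ^ 6 = a ^ 6 := by
    rw [hset, Set.mem_insert_iff, Set.mem_ofPred_eq, hs.exists_eq_mul_pow_iff ha]
  refine ⟨?_, hderiv, fun z => ?_, fun h => ?_⟩
  · rw [hset, hs.ncard_insert_zero_mul_pow (by norm_num) ha]
  · rw [hderiv, hmem, hmem, mul_pow, hs6, one_mul, mul_eq_zero,
      or_iff_right (hs.ne_zero (by norm_num))]
  · have h0 := congrFun (h.trans hderiv) 0
    rw [hf, mul_zero, Complex.exp_zero, mul_one] at h0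
    exact hs_prim 1 le_rfl (by norm_num) (by rw [pow_one, ← h0])
end
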